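/- There exists a uniform constant C > 0 such that for every integer m ≥ 3, every ᾱ with 0 < ᾱ ≤ 5/2, every β̄ with 1 ≤ β̄ ≤ 7/2, every γ̄ with 2 ≤ γ̄ ≤ 9/2, and every s > 0, the following hold: s^{ᾱ} |F_m(s)| ≤ C ᾱ^{−1} ln m, and s^{β̄} |F_m'(s)| + s^{γ̄} |F_m''(s)| ≤ C ln m. -/

import Mathlib

open Real MeasureTheory

noncomputable section

/-- `F_m(s) = ∫₀^π cos(mθ)/√(s + 2(1 − cos θ)) dθ`. -/
def Fm (m : ℕ) (s : ℝ) : ℝ :=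
  ∫ θ in (0:ℝ)..Real.pi, Real.cos (m * θ) / Real.sqrt (s + 2 * (1 - Real.cos θ))

/-- `F_m'(s) = −(1/2)∫₀^π cos(mθ)(s + 2(1 − cos θ))^{−3/2} dθ`. -/
def Fm' (m : ℕ) (s : ℝ) : ℝ :=
  -(1/2) * ∫ θ in (0:ℝ)..Real.pi, Real.cos (m * θ) * (s + 2 * (1 - Real.cos θ)) ^ (-(3:ℝ)/2)

/-- `F_m''(s) = (3/4)∫₀^π cos(mθ)(s + 2(1 − cos θ))^{−5/2} dθ`. -/
def Fm'' (m : ℕ) (s : ℝ) : ℝ :=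
  (3/4) * ∫ θ in (0:ℝ)..Real.pi, Real.cos (m * θ) * (s + 2 * (1 - Real.cos θ)) ^ (-(5:ℝ)/2)

/-- The common shape of the three integrals: `∫₀^π cos(mθ)(s + 2(1 − cos θ))^{−p} dθ`. -/
def cosPowIntegral (m : ℕ) (p s : ℝ) : ℝ :=
  ∫ θ in (0:ℝ)..Real.pi, Real.cos (m * θ) * (s + 2 * (1 - Real.cos θ)) ^ (-p)

lemma add_two_mul_one_sub_cos_pos {s : ℝ} (hs : 0 < s) (θ : ℝ) :
    0 < s + 2 * (1 - Real.cos θ) := by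
  linarith [Real.cos_le_one θ]

lemma continuous_cosPow {s : ℝ} (hs : 0 < s) (p : ℝ) :
    Continuous fun θ : ℝ => (s + 2 * (1 - Real.cos θ)) ^ (-p) :=
  (by fun_prop : Continuous fun θ : ℝ => s + 2 * (1 - Real.cos θ)).rpow_const
    fun θ => Or.inl (add_two_mul_one_sub_cos_pos hs θ).ne'

lemma sq_half_le_two_mul_one_sub_cos {θ : ℝ} (h0 : 0 ≤ θ) (hπ : θ ≤ Real.pi) :
    (θ / 2) ^ 2 ≤ 2 * (1 - Real.cos θ) := by
  have h := Real.cos_le_one_sub_mul_cos_sq (x := θ) (by rwa [abs_of_nonneg h0])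
  have hpi : (1 : ℝ) / 8 ≤ 2 / Real.pi ^ 2 := by
    rw [div_le_div_iff₀ (by norm_num) (by positivity)]
    nlinarith [Real.pi_pos, Real.pi_le_four]
  nlinarith [mul_le_mul_of_nonneg_right hpi (sq_nonneg θ)]

lemma mul_abs_cosPowIntegral_le (m : ℕ) {p s c : ℝ} {g : ℝ → ℝ} (hs : 0 < s) (hc : 0 ≤ c)
    (hg : IntervalIntegrable g volume 0 Real.pi)
    (h : ∀ θ ∈ Set.Ioc 0 Real.pi, c * (s + 2 * (1 - Real.cos θ)) ^ (-p) ≤ g θ) :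
    c * |cosPowIntegral m p s| ≤ ∫ θ in (0:ℝ)..Real.pi, g θ := by
  rw [← abs_of_nonneg hc, ← abs_mul, cosPowIntegral, ← intervalIntegral.integral_const_mul,
    ← Real.norm_eq_abs]
  refine intervalIntegral.norm_integral_le_of_norm_le Real.pi_pos.le
    (Filter.Eventually.of_forall fun θ hθ => le_trans ?_ (h θ hθ)) hg
  have hpos := Real.rpow_pos_of_pos (add_two_mul_one_sub_cos_pos hs θ) (-p)
  rw [Real.norm_eq_abs, abs_mul, abs_mul, abs_of_nonneg hc, abs_of_pos hpos]
  exact mul_le_mul_of_nonneg_left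
    (mul_le_of_le_one_left hpos.le (Real.abs_cos_le_one _)) hc

lemma abs_one_add_rpow_neg_sub_linear_le {p x : ℝ} (hp : 0 ≤ p) (hx : 0 ≤ x) :
    |(1 + x) ^ (-p) - (1 - p * x)| ≤ p * (p + 1) * x ^ 2 := by
  have h1 : 0 < 1 + x := by linarith
  have hlog_le : Real.log (1 + x) ≤ x := by linarith [Real.log_le_sub_one_of_pos h1]
  have hlog_ge : x / (1 + x) ≤ Real.log (1 + x) := by
    refine le_trans (le_of_eq ?_) (Real.one_sub_inv_le_log_of_pos h1)
    field_simp
    ring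
  have hlower : 1 - p * x ≤ (1 + x) ^ (-p) := by
    rw [Real.rpow_def_of_pos h1]
    nlinarith [Real.add_one_le_exp (Real.log (1 + x) * -p), mul_le_mul_of_nonneg_left hlog_le hp]
  have hupper : (1 + x) ^ (-p) ≤ (1 + x) / (1 + x + p * x) := by
    have hge : (1 + x + p * x) / (1 + x) ≤ (1 + x) ^ p := by
      rw [Real.rpow_def_of_pos h1]
      have he : (1 + x + p * x) / (1 + x) = p * (x / (1 + x)) + 1 := by
        field_simp
        ring
      rw [he]
      nlinarith [Real.add_one_le_exp (Real.log (1 + x) * p),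
        mul_le_mul_of_nonneg_left hlog_ge hp]
    rw [Real.rpow_neg h1.le, ← inv_div]
    exact inv_anti₀ (by positivity) hge
  have hrat : (1 + x) / (1 + x + p * x) ≤ 1 - p * x + p * (p + 1) * x ^ 2 := by
    rw [div_le_iff₀ (by positivity)]
    have : 0 ≤ p * (p + 1) ^ 2 * x ^ 3 := by positivity
    nlinarith
  rw [abs_le]
  exact ⟨by nlinarith [mul_nonneg (mul_nonneg hp (by linarith : 0 ≤ p + 1)) (sq_nonneg x)],
    by linarith⟩

lemma integral_cos_mul_eq_zero {k : ℤ} (hk : k ≠ 0) :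
    ∫ θ in (0:ℝ)..Real.pi, Real.cos (k * θ) = 0 := by
  have hk' : (k : ℝ) ≠ 0 := by exact_mod_cast hk
  rw [intervalIntegral.integral_comp_mul_left (fun x => Real.cos x) hk', integral_cos,
    Real.sin_int_mul_pi]
  simp

lemma integral_cos_mul_affine_cos_eq_zero {m : ℕ} (hm : 2 ≤ m) (a b : ℝ) :
    ∫ θ in (0:ℝ)..Real.pi, Real.cos (m * θ) * (a + b * Real.cos θ) = 0 := by
  have he : ∀ θ : ℝ, Real.cos (m * θ) * (a + b * Real.cos θ) =
      a * Real.cos (((m : ℤ) : ℝ) * θ) + (b / 2 * Real.cos (((m + 1 : ℤ) : ℝ) * θ) +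
        b / 2 * Real.cos (((m - 1 : ℤ) : ℝ) * θ)) := by
    intro θ
    push_cast
    rw [add_mul, sub_mul, one_mul, Real.cos_add, Real.cos_sub]
    ring
  simp_rw [he]
  rw [intervalIntegral.integral_add, intervalIntegral.integral_add,
    intervalIntegral.integral_const_mul, intervalIntegral.integral_const_mul,
    intervalIntegral.integral_const_mul, integral_cos_mul_eq_zero (by omega),
    integral_cos_mul_eq_zero (by omega), integral_cos_mul_eq_zero (by omega)]
  · ring
  all_goals exact Continuous.intervalIntegrable (by fun_prop) _ _

lemma rpow_add_two_mul_abs_cosPowIntegral_le {m : ℕ} (hm : 2 ≤ m) {p s : ℝ} (hp : 0 ≤ p)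
    (hs : 0 < s) :
    s ^ (p + 2) * |cosPowIntegral m p s| ≤ 16 * p * (p + 1) * Real.pi := by
  have hsplit : s ^ (p + 2) * cosPowIntegral m p s = ∫ θ in (0:ℝ)..Real.pi, Real.cos (m * θ) *
      (s ^ (p + 2) * (s + 2 * (1 - Real.cos θ)) ^ (-p) -
        ((s ^ 2 - 2 * p * s) + 2 * p * s * Real.cos θ)) := by
    rw [cosPowIntegral, ← intervalIntegral.integral_const_mul]
    have hcont := continuous_cosPow hs p
    simp_rw [mul_sub (Real.cos _)]
    rw [intervalIntegral.integral_sub, integral_cos_mul_affine_cos_eq_zero hm, sub_zero]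
    · congr 1
      ext θ
      ring
    all_goals exact Continuous.intervalIntegrable (by fun_prop) _ _
  have hs2 : 0 ≤ s ^ (p + 2) := by positivity
  rw [← abs_of_nonneg hs2, ← abs_mul, hsplit, ← Real.norm_eq_abs]
  refine (intervalIntegral.norm_integral_le_of_norm_le_const
    (C := 16 * p * (p + 1)) fun θ _ => ?_).trans_eq ?_
  · set t := 2 * (1 - Real.cos θ) with ht
    have ht0 : 0 ≤ t := by linarith [Real.cos_le_one θ]
    have ht4 : t ≤ 4 := by linarith [Real.neg_one_le_cos θ]
    have hx : 0 ≤ t / s := by positivity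
    have hfac : s ^ (p + 2) * (s + t) ^ (-p) = s ^ 2 * (1 + t / s) ^ (-p) := by
      rw [show s + t = s * (1 + t / s) by field_simp, Real.mul_rpow hs.le (by positivity),
        ← mul_assoc, ← Real.rpow_add hs]
      norm_num
    have hrem : s ^ (p + 2) * (s + t) ^ (-p) - ((s ^ 2 - 2 * p * s) + 2 * p * s * Real.cos θ) =
        s ^ 2 * ((1 + t / s) ^ (-p) - (1 - p * (t / s))) := by
      rw [hfac, ht]
      field_simp
      ring
    rw [hrem, Real.norm_eq_abs, abs_mul, abs_mul, abs_of_nonneg (sq_nonneg s)]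
    calc |Real.cos (m * θ)| * (s ^ 2 * |(1 + t / s) ^ (-p) - (1 - p * (t / s))|)
        ≤ s ^ 2 * |(1 + t / s) ^ (-p) - (1 - p * (t / s))| :=
          mul_le_of_le_one_left (by positivity) (Real.abs_cos_le_one _)
      _ ≤ s ^ 2 * (p * (p + 1) * (t / s) ^ 2) := by
          gcongr
          exact abs_one_add_rpow_neg_sub_linear_le hp hx
      _ = p * (p + 1) * t ^ 2 := by field_simp
      _ ≤ p * (p + 1) * 4 ^ 2 := by gcongr
      _ = 16 * p * (p + 1) := by ring
  · rw [sub_zero, abs_of_pos Real.pi_pos]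

lemma rpow_sub_half_mul_abs_cosPowIntegral_le (m : ℕ) {p s : ℝ} (hp : 1 ≤ p) (hs : 0 < s) :
    s ^ (p - 1 / 2) * |cosPowIntegral m p s| ≤ Real.pi := by
  have hpos : ∀ θ : ℝ, 0 < s + (θ / 2) ^ 2 := fun θ => by positivity
  have hcont : Continuous fun θ : ℝ => √s / (s + (θ / 2) ^ 2) :=
    Continuous.div (by fun_prop) (by fun_prop) fun θ => (hpos θ).ne'
  have hderiv : ∀ θ : ℝ, HasDerivAt (fun θ => 2 * Real.arctan (θ / (2 * √s)))
      (√s / (s + (θ / 2) ^ 2)) θ := by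
    intro θ
    have hr : 0 < √s := Real.sqrt_pos.2 hs
    have hsq : √s ^ 2 = s := Real.sq_sqrt hs.le
    have := (((hasDerivAt_id θ).div_const (2 * √s)).arctan).const_mul 2
    refine this.congr_deriv ?_
    simp only [id]
    rw [div_pow, mul_pow, hsq, div_pow]
    field_simp
    rw [hsq]
  refine (mul_abs_cosPowIntegral_le m hs (by positivity) (hcont.intervalIntegrable _ _)
    fun θ hθ => ?_).trans ?_
  · have ht := sq_half_le_two_mul_one_sub_cos hθ.1.le hθ.2
    have hA := add_two_mul_one_sub_cos_pos hs θ
    set A := s + 2 * (1 - Real.cos θ)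
    have hsA : s ≤ A := by linarith [sq_nonneg (θ / 2)]
    calc s ^ (p - 1 / 2) * A ^ (-p) = √s * (s ^ (p - 1) * (A ^ (-(p - 1)) * A ^ (-1 : ℝ))) := by
          rw [← Real.rpow_add hA, Real.sqrt_eq_rpow, ← mul_assoc, ← Real.rpow_add hs]
          ring_nf
      _ ≤ √s * (A ^ (p - 1) * (A ^ (-(p - 1)) * A ^ (-1 : ℝ))) := by gcongr
      _ = √s / A := by
          rw [← mul_assoc (A ^ (p - 1)), ← Real.rpow_add hA, add_neg_cancel, Real.rpow_zero,
            one_mul, Real.rpow_neg_one, div_eq_mul_inv]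
      _ ≤ √s / (s + (θ / 2) ^ 2) :=
          div_le_div_of_nonneg_left (Real.sqrt_nonneg s) (hpos θ) (by linarith)
  · rw [intervalIntegral.integral_eq_sub_of_hasDerivAt (fun θ _ => hderiv θ)
      (hcont.intervalIntegrable _ _)]
    simp only [zero_div, Real.arctan_zero]
    linarith [Real.arctan_lt_pi_div_two (Real.pi / (2 * √s))]

lemma rpow_mul_abs_cosPowIntegral_half_le (m : ℕ) {α s : ℝ} (hα : 0 < α) (hα' : α ≤ 1 / 2)
    (hs : 0 < s) :
    s ^ α * |cosPowIntegral m (1 / 2) s| ≤ Real.pi * α⁻¹ := by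
  have hint : IntervalIntegrable (fun θ : ℝ => (θ / 2) ^ (2 * α - 1)) volume 0 Real.pi := by
    have h := (intervalIntegral.intervalIntegrable_rpow' (a := 0) (b := Real.pi)
      (by linarith : -1 < 2 * α - 1)).mul_const ((2 ^ (2 * α - 1))⁻¹)
    refine h.congr fun θ hθ => ?_
    rw [Set.uIoc_of_le Real.pi_pos.le] at hθ
    rw [Real.div_rpow hθ.1.le (by norm_num), div_eq_mul_inv]
  refine (mul_abs_cosPowIntegral_le m hs (by positivity) hint fun θ hθ => ?_).trans ?_
  · have ht := sq_half_le_two_mul_one_sub_cos hθ.1.le hθ.2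
    have hA := add_two_mul_one_sub_cos_pos hs θ
    have hθ2 : 0 < θ / 2 := by linarith [hθ.1]
    set A := s + 2 * (1 - Real.cos θ)
    calc s ^ α * A ^ (-(1 / 2) : ℝ) ≤ A ^ α * A ^ (-(1 / 2) : ℝ) := by
          gcongr
          linarith [sq_nonneg (θ / 2)]
      _ = A ^ (α - 1 / 2) := by rw [← Real.rpow_add hA, sub_eq_add_neg]
      _ ≤ ((θ / 2) ^ 2) ^ (α - 1 / 2) :=
          Real.rpow_le_rpow_of_nonpos (by positivity) (by linarith) (by linarith)
      _ = (θ / 2) ^ (2 * α - 1) := by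
          rw [← Real.rpow_natCast, ← Real.rpow_mul hθ2.le]
          push_cast
          ring_nf
  · rw [intervalIntegral.integral_comp_div (fun x => x ^ (2 * α - 1)) (by norm_num : (2:ℝ) ≠ 0),
      integral_rpow (Or.inl (by linarith)), zero_div, sub_add_cancel,
      Real.zero_rpow (by positivity), sub_zero, smul_eq_mul]
    have h1 : (Real.pi / 2) ^ (2 * α) ≤ Real.pi / 2 := by
      conv_rhs => rw [← Real.rpow_one (Real.pi / 2)]
      exact Real.rpow_le_rpow_of_exponent_le (by linarith [Real.two_le_pi]) (by linarith)
    calc 2 * ((Real.pi / 2) ^ (2 * α) / (2 * α)) = (Real.pi / 2) ^ (2 * α) * α⁻¹ := by field_simp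
      _ ≤ Real.pi * α⁻¹ := by
          gcongr
          linarith [Real.pi_pos]

lemma rpow_mul_le_of_mem_Icc {s x a b X C : ℝ} (hs : 0 < s) (hX : 0 ≤ X) (hax : a ≤ x)
    (hxb : x ≤ b) (ha : s ^ a * X ≤ C) (hb : s ^ b * X ≤ C) : s ^ x * X ≤ C := by
  rcases le_total s 1 with h | h
  · exact (mul_le_mul_of_nonneg_right
      (Real.rpow_le_rpow_of_exponent_ge hs h hax) hX).trans ha
  · exact (mul_le_mul_of_nonneg_right
      (Real.rpow_le_rpow_of_exponent_le h hxb) hX).trans hb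

lemma Fm_eq_cosPowIntegral (m : ℕ) {s : ℝ} (hs : 0 < s) : Fm m s = cosPowIntegral m (1 / 2) s := by
  unfold Fm cosPowIntegral
  congr 1
  ext θ
  rw [Real.rpow_neg (add_two_mul_one_sub_cos_pos hs θ).le, ← Real.sqrt_eq_rpow, div_eq_mul_inv]

lemma Fm'_eq_cosPowIntegral (m : ℕ) (s : ℝ) :
    Fm' m s = -(1 / 2) * cosPowIntegral m (3 / 2) s := by
  rw [Fm', cosPowIntegral, neg_div]

lemma Fm''_eq_cosPowIntegral (m : ℕ) (s : ℝ) :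
    Fm'' m s = 3 / 4 * cosPowIntegral m (5 / 2) s := by
  rw [Fm'', cosPowIntegral, neg_div]

lemma rpow_mul_abs_Fm_le {m : ℕ} (hm : 2 ≤ m) {α s : ℝ} (hα : 0 < α) (hα' : α ≤ 5 / 2)
    (hs : 0 < s) : s ^ α * |Fm m s| ≤ 30 * Real.pi * α⁻¹ := by
  have hπ := Real.pi_pos
  rw [Fm_eq_cosPowIntegral m hs]
  rcases le_total α (1 / 2) with h | h
  · refine (rpow_mul_abs_cosPowIntegral_half_le m hα h hs).trans ?_
    gcongr
    linarith
  · have hinv : 2 / 5 ≤ α⁻¹ := by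
      rw [le_inv_comm₀ (by norm_num) hα]
      norm_num
      exact hα'
    have h1 := rpow_mul_abs_cosPowIntegral_half_le m (α := 1 / 2) (by norm_num) le_rfl hs
    have h2 := rpow_add_two_mul_abs_cosPowIntegral_le hm (p := 1 / 2) (by norm_num) hs
    norm_num at h1 h2
    refine (rpow_mul_le_of_mem_Icc (C := 12 * Real.pi) hs (abs_nonneg _) h hα' ?_ ?_).trans ?_
    · norm_num
      linarith
    · norm_num
      linarith
    · nlinarith [mul_le_mul_of_nonneg_left hinv hπ.le]

lemma rpow_mul_abs_cosPowIntegral_le {m : ℕ} (hm : 2 ≤ m) {p x s : ℝ} (hp : 1 ≤ p)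
    (hx : p - 1 / 2 ≤ x) (hx' : x ≤ p + 2) (hs : 0 < s) :
    s ^ x * |cosPowIntegral m p s| ≤ 16 * p * (p + 1) * Real.pi := by
  refine rpow_mul_le_of_mem_Icc hs (abs_nonneg _) hx hx'
    ((rpow_sub_half_mul_abs_cosPowIntegral_le m hp hs).trans ?_)
    (rpow_add_two_mul_abs_cosPowIntegral_le hm (by linarith) hs)
  exact le_mul_of_one_le_left Real.pi_pos.le (by nlinarith)

/-- Lemma 2.3 (propa2), part (ii): logarithmic-in-`m` bounds on `F_m`, `F_m'`, `F_m''`. -/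
theorem Fm_log_m_bounds :
    ∃ C : ℝ, 0 < C ∧ ∀ (m : ℕ), 3 ≤ m → ∀ (α β γ s : ℝ),
      0 < α → α ≤ 5/2 →
      1 ≤ β → β ≤ 7/2 →
      2 ≤ γ → γ ≤ 9/2 →
      0 < s →
      s ^ α * |Fm m s| ≤ C * α⁻¹ * Real.log (m : ℝ) ∧
      s ^ β * |Fm' m s| + s ^ γ * |Fm'' m s| ≤ C * Real.log (m : ℝ) := by
  refine ⟨200 * Real.pi, by positivity, fun m hm α β γ s hα hα' hβ hβ' hγ hγ' hs => ?_⟩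
  have hπ := Real.pi_pos
  have hm2 : 2 ≤ m := by omega
  have hlog : 1 ≤ Real.log (m : ℝ) := by
    have h3 : (3 : ℝ) ≤ m := by exact_mod_cast hm
    rw [Real.le_log_iff_exp_le (by linarith)]
    linarith [Real.exp_one_lt_d9]
  constructor
  · calc s ^ α * |Fm m s| ≤ 30 * Real.pi * α⁻¹ := rpow_mul_abs_Fm_le hm2 hα hα' hs
      _ ≤ 200 * Real.pi * α⁻¹ := by gcongr; norm_num
      _ ≤ 200 * Real.pi * α⁻¹ * Real.log (m : ℝ) := le_mul_of_one_le_right (by positivity) hlog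
  · have h1 := rpow_mul_abs_cosPowIntegral_le hm2 (p := 3 / 2) (x := β) (by norm_num)
      (by linarith) (by linarith) hs
    have h2 := rpow_mul_abs_cosPowIntegral_le hm2 (p := 5 / 2) (x := γ) (by norm_num)
      (by linarith) (by linarith) hs
    rw [Fm'_eq_cosPowIntegral, Fm''_eq_cosPowIntegral, abs_mul, abs_mul, abs_neg,
      abs_of_pos (by norm_num : (0:ℝ) < 1 / 2), abs_of_pos (by norm_num : (0:ℝ) < 3 / 4)]
    refine le_trans ?_ (le_mul_of_one_le_right (by positivity) hlog)
    nlinarith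

end
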